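/- If n and s are positive integers with n ≥ max{2, s}, then ĝ(n,s) ≤ 11·√(ns)·lg n, where lg denotes the base-2 logarithm. -/

import Mathlib

namespace AltitudePaper

/-- The contents of one column after its ungrounded tokens each shift down one cell.
A column is a set of occupied rows; its grounded tokens are the initial segment
`[0, sInf Tᶜ)`, which stay put, and every ungrounded token moves down one row. -/
def shiftDown (T : Set ℕ) : Set ℕ :=
  {i | i ∈ T ∧ i < sInf Tᶜ} ∪ {i | sInf Tᶜ ≤ i ∧ i + 1 ∈ T}

/-- A token game (together with a play of it).  `board t` is the array `B_t` (for
`0 ≤ t ≤ len`): each column (indexed by `Fin n`) is the set of rows occupied by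
tokens.  `active t` is the active column at step `t`, advancing cyclically.  `move t`
records the player's optional move at step `t`: `some (v, i, i')` means the highest
grounded token of the active column, in row `i`, is moved to the empty cell in
row `i' ≤ i` of column `v` (allowed only if no earlier step moved a token between
these two columns); afterwards the ungrounded tokens of the active column shift down
one cell. -/
structure TokenGame (n : ℕ) where
  /-- number of steps -/
  len : ℕ
  /-- the array after `t` steps: each column is the set of rows occupied by tokens -/
  board : ℕ → Fin n → Set ℕ
  /-- the active column at each step -/
  active : ℕ → Fin n
  /-- the optional move at each step: target column, source row, target row -/
  move : ℕ → Option (Fin n × ℕ × ℕ)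
  /-- the active column advances cyclically -/
  active_succ : ∀ t, (active (t + 1)).val = ((active t).val + 1) % n
  /-- a step with no token moved: the ungrounded tokens of the active column shift
  down one cell -/
  step_none : ∀ t < len, move t = none →
    ∀ w, board (t + 1) w =
      if w = active t then shiftDown (board t (active t)) else board t w
  /-- a step moving a token: the token moved is the highest grounded token of the
  active column, it moves to an empty cell in a weakly lower row of another column,
  no earlier step moved a token between these two columns, and then the ungrounded
  tokens of the active column shift down one cell -/
  step_some : ∀ t < len, ∀ v i i', move t = some (v, i, i') →
    v ≠ active t ∧
    (∀ j ≤ i, j ∈ board t (active t)) ∧ i + 1 ∉ board t (active t) ∧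
    i' ≤ i ∧ i' ∉ board t v ∧
    (∀ t' < t, ∀ v' i₀ i₀', move t' = some (v', i₀, i₀') →
      ¬((active t' = active t ∧ v' = v) ∨ (active t' = v ∧ v' = active t))) ∧
    (∀ w, board (t + 1) w =
      if w = active t then shiftDown (board t (active t) \ {i})
      else if w = v then insert i' (board t v) else board t w)

/-- The number of transfer steps (steps moving a token between two columns) of a
token game. -/
def transferCount {n : ℕ} (g : TokenGame n) : ℕ :=
  ((Finset.range g.len).filter fun t => (g.move t).isSome).card

/-- The number of transfer steps among steps `t₁ ≤ t < t₂` of a token game;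
these are the transfer steps of the subgame with transcript `B_{t₁}, …, B_{t₂}`. -/
def transferCountBetween {n : ℕ} (g : TokenGame n) (t₁ t₂ : ℕ) : ℕ :=
  ((Finset.Ico t₁ t₂).filter fun t => (g.move t).isSome).card

/-- `ĝ(n, s)`: the maximum number of tokens that can be placed in a single column in
an `(n,s)`-token game (a token game with `n` columns, each initially containing at
most `s` tokens). -/
noncomputable def ghat (n s : ℕ) : ℕ :=
  sSup {k | ∃ g : TokenGame n, (∀ u, (g.board 0 u).Finite) ∧
    (∀ u, (g.board 0 u).ncard ≤ s) ∧ ∃ t ≤ g.len, ∃ u, k = (g.board t u).ncard}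


/-- The number of tokens of column `u` in rows `≥ h` at time `t`. -/
noncomputable def wt {n : ℕ} (g : TokenGame n) (h t : ℕ) (u : Fin n) : ℕ :=
  (g.board t u ∩ Set.Ici h).ncard

lemma shiftDown_image (T : Set ℕ) (h : ℕ) :
    (fun i => if i < sInf Tᶜ then i else i + 1) '' (shiftDown T ∩ Set.Ici h) ⊆ T ∩ Set.Ici h := by
  rintro _ ⟨i, ⟨hi, hh⟩, rfl⟩
  simp only [Set.mem_Ici] at hh
  rcases hi with ⟨h1, h2⟩ | ⟨h1, h2⟩
  · simp only [h2, if_true]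
    exact ⟨h1, hh⟩
  · have : ¬ i < sInf Tᶜ := by omega
    simp only [this, if_false]
    exact ⟨h2, by simp only [Set.mem_Ici]; omega⟩

lemma shiftDown_inj (T : Set ℕ) :
    Function.Injective (fun i => if i < sInf Tᶜ then i else i + 1) := by
  intro i j hij
  simp only at hij
  split_ifs at hij <;> omega

lemma shiftDown_finite {T : Set ℕ} (hT : T.Finite) : (shiftDown T).Finite := by
  have h := shiftDown_image T 0
  have h2 := (hT.inter_of_left (Set.Ici 0)).subset h
  have h3 := Set.Finite.of_finite_image h2 (shiftDown_inj T).injOn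
  refine h3.subset ?_
  intro x hx
  exact ⟨hx, Nat.zero_le _⟩

lemma shiftDown_ncard {T : Set ℕ} (hT : T.Finite) (h : ℕ) :
    (shiftDown T ∩ Set.Ici h).ncard ≤ (T ∩ Set.Ici h).ncard := by
  rw [← Set.ncard_image_of_injective _ (shiftDown_inj T)]
  exact Set.ncard_le_ncard (shiftDown_image T h) (hT.inter_of_left _)

lemma board_finite {n : ℕ} (g : TokenGame n) (h0 : ∀ u, (g.board 0 u).Finite) :
    ∀ t ≤ g.len, ∀ u, (g.board t u).Finite := by
  intro t
  induction t with
  | zero => intro _ u; exact h0 u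
  | succ t ih =>
    intro ht u
    have ih := ih (by omega)
    rcases hm : g.move t with _ | ⟨v, i, i'⟩
    · rw [g.step_none t (by omega) hm u]
      split_ifs
      · exact shiftDown_finite (ih _)
      · exact ih _
    · obtain ⟨-, -, -, -, -, -, hb⟩ := g.step_some t (by omega) v i i' hm
      rw [hb u]
      split_ifs
      · exact shiftDown_finite ((ih _).subset Set.sdiff_subset)
      · exact (ih _).insert _
      · exact ih _

lemma wt_none {n : ℕ} (g : TokenGame n) (h0 : ∀ u, (g.board 0 u).Finite) (h t : ℕ)
    (ht : t < g.len) (hm : g.move t = none) (u : Fin n) : wt g h (t + 1) u ≤ wt g h t u := by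
  unfold wt
  rw [g.step_none t ht hm u]
  split_ifs with h1
  · subst h1
    exact shiftDown_ncard (board_finite g h0 t ht.le _) h
  · exact le_rfl

/-- Behaviour of the weights at a transfer step. -/
lemma wt_some {n : ℕ} (g : TokenGame n) (h0 : ∀ u, (g.board 0 u).Finite) (h t : ℕ)
    (ht : t < g.len) (v : Fin n) (i i' : ℕ) (hm : g.move t = some (v, i, i')) (u : Fin n) :
    wt g h (t + 1) u ≤ wt g h t u + (if u = v ∧ h ≤ i' then 1 else 0) := by
  have hf := board_finite g h0 t ht.le
  obtain ⟨hv, -, -, -, -, -, hb⟩ := g.step_some t ht v i i' hm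
  unfold wt
  rw [hb u]
  by_cases h1 : u = g.active t
  · rw [if_pos h1, h1]
    refine le_trans (shiftDown_ncard ((hf _).subset Set.sdiff_subset) h) ?_
    refine le_trans (Set.ncard_le_ncard ?_ ((hf (g.active t)).inter_of_left _)) (Nat.le_add_right _ _)
    exact Set.inter_subset_inter_left _ Set.sdiff_subset
  · rw [if_neg h1]
    by_cases h2 : u = v
    · subst h2
      rw [if_pos rfl]
      by_cases h3 : h ≤ i'
      · rw [if_pos ⟨rfl, h3⟩, Set.insert_inter_of_mem (by exact h3)]
        exact Set.ncard_insert_le _ _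
      · rw [Set.insert_inter_of_notMem (by exact h3)]
        exact Nat.le_add_right _ _
    · rw [if_neg h2]
      exact Nat.le_add_right _ _

lemma wt_zero {n : ℕ} (g : TokenGame n) (t : ℕ) (u : Fin n) :
    wt g 0 t u = (g.board t u).ncard := by
  unfold wt
  congr 1
  ext x; simp

lemma wt_active {n : ℕ} (g : TokenGame n) (h0 : ∀ u, (g.board 0 u).Finite) (t : ℕ)
    (ht : t < g.len) (v : Fin n) (i i' : ℕ) (hm : g.move t = some (v, i, i')) :
    wt g 0 (t + 1) (g.active t) + 1 ≤ wt g 0 t (g.active t) := by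
  have hf := board_finite g h0 t ht.le
  obtain ⟨hv, hg, -, -, -, -, hb⟩ := g.step_some t ht v i i' hm
  rw [wt_zero g t]
  unfold wt
  rw [hb, if_pos rfl]
  have h1 := shiftDown_ncard ((hf (g.active t)).subset (Set.sdiff_subset (t := {i}))) 0
  have h2 : (g.board t (g.active t) \ {i}).ncard + 1 = (g.board t (g.active t)).ncard :=
    Set.ncard_sdiff_singleton_add_one (hg i le_rfl) (hf _)
  have h3 : (g.board t (g.active t) \ {i}) ∩ Set.Ici 0 = g.board t (g.active t) \ {i} := by
    ext x; simp
  rw [h3] at h1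
  omega

lemma total_step {n : ℕ} (g : TokenGame n) (h0 : ∀ u, (g.board 0 u).Finite) (t : ℕ)
    (ht : t < g.len) : ∑ u, wt g 0 (t + 1) u ≤ ∑ u, wt g 0 t u := by
  rcases hm : g.move t with _ | ⟨v, i, i'⟩
  · exact Finset.sum_le_sum fun u _ => wt_none g h0 0 t ht hm u
  · have hva := (g.step_some t ht v i i' hm).1
    have key : ∑ u, (wt g 0 (t + 1) u + (if u = g.active t then 1 else 0)) ≤
        ∑ u, (wt g 0 t u + (if u = v then 1 else 0)) := by
      refine Finset.sum_le_sum fun u _ => ?_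
      by_cases hu : u = g.active t
      · have := wt_active g h0 t ht v i i' hm
        rw [if_pos hu, hu]
        omega
      · have := wt_some g h0 0 t ht v i i' hm u
        simp only [Nat.zero_le, and_true] at this
        rw [if_neg hu]
        omega
    simp only [Finset.sum_add_distrib, Finset.sum_ite_eq', Finset.mem_univ, if_true] at key
    omega

lemma total_le {n : ℕ} (g : TokenGame n) (h0 : ∀ u, (g.board 0 u).Finite) {N : ℕ}
    (hN : ∑ u, wt g 0 0 u ≤ N) : ∀ t ≤ g.len, ∑ u, wt g 0 t u ≤ N := by
  intro t
  induction t with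
  | zero => intro _; exact hN
  | succ t ih => intro ht; exact (total_step g h0 t ht).trans (ih (by omega))

lemma wt_le_zero {n : ℕ} (g : TokenGame n) (h0 : ∀ u, (g.board 0 u).Finite) (h t : ℕ)
    (ht : t ≤ g.len) (u : Fin n) : wt g h t u ≤ wt g 0 t u := by
  rw [wt_zero]
  exact Set.ncard_le_ncard Set.inter_subset_left (board_finite g h0 t ht u)

lemma zero_le_wt {n : ℕ} (g : TokenGame n) (h0 : ∀ u, (g.board 0 u).Finite) (h t : ℕ)
    (ht : t ≤ g.len) (u : Fin n) : wt g 0 t u ≤ wt g h t u + h := by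
  rw [wt_zero]
  have hsub : g.board t u ⊆ (g.board t u ∩ Set.Ici h) ∪ (Finset.range h : Set ℕ) := by
    intro x hx
    by_cases hh : h ≤ x
    · exact Or.inl ⟨hx, hh⟩
    · right; simp; omega
  have h1 := Set.ncard_le_ncard hsub
    (((board_finite g h0 t ht u).inter_of_left _).union (Finset.finite_toSet _))
  have h2 := Set.ncard_union_le (g.board t u ∩ Set.Ici h) (Finset.range h : Set ℕ)
  rw [Set.ncard_coe_finset, Finset.card_range] at h2
  unfold wt
  omega

open Classical in
/-- Columns having at least `h` tokens at some time in `[x, y)`. -/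
noncomputable def tall {n : ℕ} (g : TokenGame n) (h x y : ℕ) : Finset (Fin n) :=
  Finset.univ.filter fun v => ∃ t, x ≤ t ∧ t < y ∧ h ≤ wt g 0 t v

lemma mem_tall {n : ℕ} (g : TokenGame n) (h x y : ℕ) (v : Fin n) :
    v ∈ tall g h x y ↔ ∃ t, x ≤ t ∧ t < y ∧ h ≤ wt g 0 t v := by
  simp [tall]

lemma tall_empty {n : ℕ} (g : TokenGame n) (h x y : ℕ) (hxy : y ≤ x) : tall g h x y = ∅ := by
  apply Finset.eq_empty_of_forall_notMem
  intro v hv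
  obtain ⟨t, h1, h2, -⟩ := (mem_tall g h x y v).1 hv
  omega

open Classical in
/-- Columns giving a token to `u` in a row `≥ h` at some time in `[x, y)`. -/
noncomputable def donors {n : ℕ} (g : TokenGame n) (u : Fin n) (h x y : ℕ) : Finset (Fin n) :=
  Finset.univ.filter fun v => ∃ t, x ≤ t ∧ t < y ∧ g.active t = v ∧
    ∃ i i', g.move t = some (u, i, i') ∧ h ≤ i'

lemma donors_subset {n : ℕ} (g : TokenGame n) (h0 : ∀ u, (g.board 0 u).Finite) (u : Fin n)
    (h x y : ℕ) (hy : y ≤ g.len) : donors g u h x y ⊆ tall g h x y := by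
  intro v hv
  simp only [donors, tall, Finset.mem_filter, Finset.mem_univ, true_and] at hv ⊢
  obtain ⟨t, hx, hty, rfl, i, i', hm, hi⟩ := hv
  refine ⟨t, hx, hty, ?_⟩
  obtain ⟨-, hg, -, hii, -, -, -⟩ := g.step_some t (by omega) u i i' hm
  have hsub : (Finset.range (i + 1) : Set ℕ) ⊆ g.board t (g.active t) := by
    intro j hj
    simp at hj
    exact hg j (by omega)
  have := Set.ncard_le_ncard hsub (board_finite g h0 t (by omega) _)
  rw [Set.ncard_coe_finset, Finset.card_range] at this
  rw [wt_zero]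
  omega

lemma wt_gain_donors {n : ℕ} (g : TokenGame n) (h0 : ∀ u, (g.board 0 u).Finite) (u : Fin n)
    (h x d : ℕ) (hy : x + d ≤ g.len) :
    wt g h (x + d) u ≤ wt g h x u + (donors g u h x (x + d)).card := by
  induction d with
  | zero => simp
  | succ d ih =>
    have ih := ih (by omega)
    have hmono : donors g u h x (x + d) ⊆ donors g u h x (x + (d + 1)) := by
      intro v hv
      simp only [donors, Finset.mem_filter, Finset.mem_univ, true_and] at hv ⊢
      obtain ⟨t, h1, h2, h3⟩ := hv
      exact ⟨t, h1, by omega, h3⟩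
    have hc := Finset.card_le_card hmono
    rw [← add_assoc] at *
    rcases hm : g.move (x + d) with _ | ⟨v, i, i'⟩
    · have := wt_none g h0 h (x + d) (by omega) hm u
      omega
    · have h1 := wt_some g h0 h (x + d) (by omega) v i i' hm u
      by_cases hc2 : u = v ∧ h ≤ i'
      · rw [if_pos hc2] at h1
        obtain ⟨rfl, hi⟩ := hc2
        obtain ⟨-, -, -, -, -, hp, -⟩ := g.step_some (x + d) (by omega) u i i' hm
        have hlt : (donors g u h x (x + d)).card < (donors g u h x (x + d + 1)).card := by
          apply Finset.card_lt_card
          refine (Finset.ssubset_iff_of_subset hmono).2 ⟨g.active (x + d), ?_, ?_⟩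
          · simp only [donors, Finset.mem_filter, Finset.mem_univ, true_and]
            exact ⟨x + d, by omega, by omega, rfl, i, i', hm, hi⟩
          · simp only [donors, Finset.mem_filter, Finset.mem_univ, true_and]
            rintro ⟨t, ht1, ht2, hact, j, j', hm', -⟩
            exact hp t ht2 u j j' hm' (Or.inl ⟨hact, rfl⟩)
        omega
      · rw [if_neg hc2] at h1
        omega

lemma wt_gain {n : ℕ} (g : TokenGame n) (h0 : ∀ u, (g.board 0 u).Finite) (u : Fin n)
    (h x y : ℕ) (hxy : x ≤ y) (hy : y ≤ g.len) :
    wt g h y u ≤ wt g h x u + (tall g h x y).card := by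
  obtain ⟨d, rfl⟩ := Nat.exists_eq_add_of_le hxy
  have h1 := wt_gain_donors g h0 u h x d hy
  have h2 := Finset.card_le_card (donors_subset g h0 u h x (x + d) hy)
  omega

lemma tall_mono {n : ℕ} (g : TokenGame n) (h x y z : ℕ) (hyz : y ≤ z) :
    tall g h x y ⊆ tall g h x z := by
  intro v hv
  simp only [tall, Finset.mem_filter, Finset.mem_univ, true_and] at hv ⊢
  obtain ⟨t, h1, h2, h3⟩ := hv
  exact ⟨t, h1, by omega, h3⟩

lemma tall_union {n : ℕ} (g : TokenGame n) (h x y z : ℕ) :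
    (tall g h x z).card ≤ (tall g h x y).card + (tall g h y z).card := by
  classical
  refine le_trans (Finset.card_le_card ?_) (Finset.card_union_le _ _)
  intro v hv
  simp only [tall, Finset.mem_union, Finset.mem_filter, Finset.mem_univ, true_and] at hv ⊢
  obtain ⟨t, h1, h2, h3⟩ := hv
  by_cases hty : t < y
  · exact Or.inl ⟨t, h1, hty, h3⟩
  · exact Or.inr ⟨t, by omega, h2, h3⟩

/-- In a phase with few tall columns, few columns gain `2a - 1` in height. -/
lemma phase {n : ℕ} (g : TokenGame n) (h0 : ∀ u, (g.board 0 u).Finite) {N a : ℕ}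
    (hN : ∑ u, wt g 0 0 u ≤ N) (h x y : ℕ) (hy : y ≤ g.len + 1)
    (hp : (tall g h x y).card < a) :
    (tall g (h + (2 * a - 1)) x y).card * a ≤ N := by
  by_cases hxy : x < y
  · have hx : x ≤ g.len := by omega
    calc (tall g (h + (2 * a - 1)) x y).card * a
        = ∑ u ∈ tall g (h + (2 * a - 1)) x y, a := by simp
      _ ≤ ∑ u ∈ tall g (h + (2 * a - 1)) x y, wt g 0 x u := by
          refine Finset.sum_le_sum fun u hu => ?_
          simp only [tall, Finset.mem_filter, Finset.mem_univ, true_and] at hu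
          obtain ⟨t, h1, h2, h3⟩ := hu
          have e1 := wt_gain g h0 u h x t h1 (by omega)
          have e2 := Finset.card_le_card (tall_mono g h x t y h2.le)
          have e3 := zero_le_wt g h0 h t (by omega) u
          have e4 := wt_le_zero g h0 h x hx u
          omega
      _ ≤ ∑ u, wt g 0 x u := Finset.sum_le_sum_of_subset (Finset.subset_univ _)
      _ ≤ N := total_le g h0 hN x hx
  · have : tall g (h + (2 * a - 1)) x y = ∅ :=
      tall_empty g _ x y (by omega)
    simp [this]

/-- The first time at which a phase is complete. -/
lemma first_time {n : ℕ} (g : TokenGame n) (h x a : ℕ) (ha : 0 < a) (z : ℕ)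
    (hz : a ≤ (tall g h x (z + 1)).card) :
    ∃ y ≤ z, a ≤ (tall g h x (y + 1)).card ∧ (tall g h x y).card < a ∧ x ≤ y := by
  classical
  have hex : ∃ y, a ≤ (tall g h x (y + 1)).card := ⟨z, hz⟩
  refine ⟨Nat.find hex, Nat.find_min' hex hz, Nat.find_spec hex, ?_, ?_⟩
  · rcases hy : Nat.find hex with _ | y
    · have : tall g h x 0 = ∅ :=
        tall_empty g _ x 0 (Nat.zero_le _)
      simp [this, ha]
    · have := Nat.find_min hex (m := y) (by omega)
      omega
  · have hs := Nat.find_spec hex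
    have hne : (tall g h x (Nat.find hex + 1)).Nonempty := Finset.card_pos.1 (by omega)
    obtain ⟨v, hv⟩ := hne
    rw [mem_tall] at hv
    obtain ⟨t, h1, h2, -⟩ := hv
    omega

lemma transfer_add {n : ℕ} (g : TokenGame n) (x y z w : ℕ) (hxy : x ≤ y) (hyz : y ≤ z)
    (hzw : z ≤ w) :
    transferCountBetween g x y + transferCountBetween g y z ≤ transferCountBetween g x w := by
  unfold transferCountBetween
  rw [← Finset.card_union_of_disjoint]
  · apply Finset.card_le_card
    intro t ht
    simp only [Finset.mem_union, Finset.mem_filter, Finset.mem_Ico] at ht ⊢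
    rcases ht with ⟨h1, h2⟩ | ⟨h1, h2⟩
    · exact ⟨by omega, h2⟩
    · exact ⟨by omega, h2⟩
  · rw [Finset.disjoint_left]
    intro t ht ht'
    simp only [Finset.mem_filter, Finset.mem_Ico] at ht ht'
    omega

lemma no_transfer {n : ℕ} (g : TokenGame n) (h0 : ∀ u, (g.board 0 u).Finite) (x d : ℕ)
    (hd : x + d ≤ g.len) (hm : ∀ t, x ≤ t → t < x + d → g.move t = none) (u : Fin n) :
    wt g 0 (x + d) u ≤ wt g 0 x u := by
  induction d with
  | zero => exact le_rfl
  | succ d ih =>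
    have h1 := ih (by omega) (fun t a b => hm t a (by omega))
    have h2 := wt_none g h0 0 (x + d) (by omega) (hm _ (by omega) (by omega)) u
    rw [← add_assoc]
    omega

lemma main_induction {n : ℕ} (g : TokenGame n) (h0 : ∀ u, (g.board 0 u).Finite) {N a : ℕ}
    (hN : ∑ u, wt g 0 0 u ≤ N) (ha : 2 * N < a * a) (j : ℕ) :
    ∀ x y, y ≤ g.len → a ≤ (tall g (a + j * (2 * a - 1)) x (y + 1)).card →
      2 ^ j ≤ transferCountBetween g x y := by
  have ha0 : 0 < a := by
    rcases Nat.eq_zero_or_pos a with h | h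
    · subst h; omega
    · exact h
  induction j with
  | zero =>
    intro x y hy hc
    simp only [zero_mul, add_zero] at hc
    rw [pow_zero]
    by_contra hlt
    have hz : transferCountBetween g x y = 0 := by omega
    unfold transferCountBetween at hz
    rw [Finset.card_eq_zero, Finset.filter_eq_empty_iff] at hz
    have hnone : ∀ t, x ≤ t → t < y → g.move t = none := by
      intro t h1 h2
      have := hz (Finset.mem_Ico.2 ⟨h1, h2⟩)
      simpa using this
    obtain ⟨v, hv⟩ : (tall g a x (y + 1)).Nonempty := Finset.card_pos.1 (by omega)
    have hx : x ≤ g.len := by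
      simp only [tall, Finset.mem_filter, Finset.mem_univ, true_and] at hv
      obtain ⟨t, h1, h2, -⟩ := hv
      omega
    have : (tall g a x (y + 1)).card * a ≤ N := by
      calc (tall g a x (y + 1)).card * a
          = ∑ u ∈ tall g a x (y + 1), a := by simp
        _ ≤ ∑ u ∈ tall g a x (y + 1), wt g 0 x u := by
            refine Finset.sum_le_sum fun u hu => ?_
            simp only [tall, Finset.mem_filter, Finset.mem_univ, true_and] at hu
            obtain ⟨t, h1, h2, h3⟩ := hu
            obtain ⟨d, rfl⟩ := Nat.exists_eq_add_of_le h1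
            exact h3.trans (no_transfer g h0 x d (by omega)
              (fun t a b => hnone t a (by omega)) u)
        _ ≤ ∑ u, wt g 0 x u := Finset.sum_le_sum_of_subset (Finset.subset_univ _)
        _ ≤ N := total_le g h0 hN x hx
    have h2 := Nat.mul_le_mul_right a hc
    omega
  | succ j ih =>
    intro x y hy hc
    set h := a + j * (2 * a - 1) with hh
    have hh' : a + (j + 1) * (2 * a - 1) = h + (2 * a - 1) := by rw [hh]; ring
    rw [hh'] at hc
    have hA := Nat.mul_le_mul_right a hc
    have c1 : a ≤ (tall g h x (y + 1)).card := by
      by_contra hlt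
      have := phase g h0 hN h x (y + 1) (by omega) (not_le.1 hlt)
      omega
    obtain ⟨x1, hx1, hf1, hl1, hxx⟩ := first_time g h x a ha0 y c1
    have p1 := phase g h0 hN h x x1 (by omega) hl1
    have c2 : a ≤ (tall g h x1 (y + 1)).card := by
      by_contra hlt
      have p2 := phase g h0 hN h x1 (y + 1) (by omega) (not_le.1 hlt)
      have hu := Nat.mul_le_mul_right a (tall_union g (h + (2 * a - 1)) x x1 (y + 1))
      rw [add_mul] at hu
      omega
    obtain ⟨x2, hx2, hf2, hl2, hxx2⟩ := first_time g h x1 a ha0 y c2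
    have t1 := ih x x1 (by omega) hf1
    have t2 := ih x1 x2 (by omega) hf2
    have := transfer_add g x x1 x2 y hxx hxx2 hx2
    rw [pow_succ]
    omega

lemma transfer_le {n : ℕ} (g : TokenGame n) (y : ℕ) (hy : y ≤ g.len) :
    transferCountBetween g 0 y ≤ n ^ 2 := by
  unfold transferCountBetween
  have hcard : (Finset.univ : Finset (Fin n × Fin n)).card = n ^ 2 := by
    simp [sq]
  rw [← hcard]
  refine Finset.card_le_card_of_injOn
    (fun t => (g.active t, ((g.move t).map Prod.fst).getD (g.active t)))
    (fun _ _ => Finset.mem_coe.2 (Finset.mem_univ _)) ?_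
  have key : ∀ t t', t < t' → t' < y → (g.move t).isSome → (g.move t').isSome →
      (g.active t, ((g.move t).map Prod.fst).getD (g.active t)) =
      (g.active t', ((g.move t').map Prod.fst).getD (g.active t')) → False := by
    intro t t' htt ht' hs hs' he
    obtain ⟨⟨v, i, i'⟩, hm⟩ := Option.isSome_iff_exists.1 hs
    obtain ⟨⟨v2, i2, i2'⟩, hm'⟩ := Option.isSome_iff_exists.1 hs'
    rw [hm, hm'] at he
    simp only [Option.map_some, Option.getD_some, Prod.mk.injEq] at he
    obtain ⟨-, -, -, -, -, hp, -⟩ := g.step_some t' (by omega) v2 i2 i2' hm'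
    exact hp t htt v i i' hm (Or.inl he)
  intro t ht t' ht' he
  simp only [Finset.coe_filter, Finset.mem_Ico, Set.mem_ofPred_eq] at ht ht'
  rcases lt_trichotomy t t' with hl | hl | hl
  · exact (key t t' hl ht'.1.2 ht.2 ht'.2 he).elim
  · exact hl
  · exact (key t' t hl ht.1.2 ht'.2 ht.2 he.symm).elim

lemma nat_bound {n s : ℕ} (g : TokenGame n) (h0 : ∀ u, (g.board 0 u).Finite)
    (hs : ∀ u, (g.board 0 u).ncard ≤ s) (t : ℕ) (ht : t ≤ g.len) (u : Fin n) (a J : ℕ)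
    (ha : 2 * (n * s) < a * a) (hJ : n ^ 2 < 2 ^ J) :
    (g.board t u).ncard ≤ n * s ∧ (g.board t u).ncard ≤ a + J * (2 * a - 1) + a + s := by
  have hN : ∑ u, wt g 0 0 u ≤ n * s := by
    calc ∑ u, wt g 0 0 u ≤ ∑ _u : Fin n, s :=
          Finset.sum_le_sum fun u _ => by rw [wt_zero]; exact hs u
      _ = n * s := by simp
  rw [← wt_zero]
  constructor
  · exact (Finset.single_le_sum (f := fun u => wt g 0 t u) (fun _ _ => Nat.zero_le _)
      (Finset.mem_univ u)).trans (total_le g h0 hN t ht)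
  · by_contra hlt
    set h := a + J * (2 * a - 1) with hh
    have e1 := zero_le_wt g h0 h t ht u
    have e2 := wt_gain g h0 u h 0 t (Nat.zero_le _) ht
    have e3 := wt_le_zero g h0 h 0 (Nat.zero_le _) u
    have e4 := hs u
    rw [← wt_zero] at e4
    have e5 := Finset.card_le_card (tall_mono g h 0 t (t + 1) (by omega))
    have e6 := main_induction g h0 hN ha J 0 t ht (by rw [← hh]; omega)
    have e7 := transfer_le g t ht
    omega

/-- second bound of Corollary `tgbound` of the paper.
`ĝ(n,s) ≤ 11·√(ns)·lg n` for positive integers `n, s` with `n ≥ max{2, s}`. -/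
theorem ghat_upper_bound' (n s : ℕ) (hs : 1 ≤ s) (hn : max 2 s ≤ n) :
    (ghat n s : ℝ) ≤ 11 * Real.sqrt (n * s) * Real.logb 2 n := by
  have hn2 : 2 ≤ n := (le_max_left _ _).trans hn
  have hsn : s ≤ n := (le_max_right _ _).trans hn
  set R := Real.sqrt (n * s) with hR
  set L := Real.logb 2 n with hL
  have hs' : (1 : ℝ) ≤ s := by exact_mod_cast hs
  have hn' : (2 : ℝ) ≤ n := by exact_mod_cast hn2
  have hsn' : (s : ℝ) ≤ n := by exact_mod_cast hsn
  have hR0 : 0 ≤ R := Real.sqrt_nonneg _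
  have hR2 : R * R = n * s := Real.mul_self_sqrt (by positivity)
  have hL1 : 1 ≤ L := by
    rw [hL, Real.le_logb_iff_rpow_le (by norm_num) (by linarith)]
    simpa using hn'
  have hnn : 0 ≤ 11 * R * L := by positivity
  suffices hk : ghat n s ≤ ⌊11 * R * L⌋₊ from (Nat.le_floor_iff hnn).1 hk
  unfold ghat
  refine csSup_le' ?_
  rintro k ⟨g, h0, hcard, t, ht, u, rfl⟩
  rw [Nat.le_floor_iff hnn]
  have ha : 2 * (n * s) < (Nat.sqrt (2 * (n * s)) + 1) * (Nat.sqrt (2 * (n * s)) + 1) :=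
    Nat.lt_succ_sqrt _
  have hJ : n ^ 2 < 2 ^ (Nat.log 2 (n ^ 2) + 1) := Nat.lt_pow_succ_log_self (by norm_num) _
  obtain ⟨b1, b2⟩ := nat_bound g h0 hcard t ht u _ _ ha hJ
  set k := (g.board t u).ncard
  have b1' : (k : ℝ) ≤ R * R := by rw [hR2]; exact_mod_cast b1
  by_cases hR11 : R ≤ 11
  · nlinarith [mul_nonneg hR0 (sub_nonneg.2 hL1), mul_nonneg hR0 (sub_nonneg.2 hR11)]
  push Not at hR11
  have hL3 : 3 ≤ L := by
    rw [hL, Real.le_logb_iff_rpow_le (by norm_num) (by linarith)]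
    have : (8 : ℝ) ≤ n := by nlinarith
    have h8 : (2 : ℝ) ^ (3 : ℝ) = 8 := by norm_num
    rw [h8]; exact this
  have hlog : (Nat.log 2 (n ^ 2) : ℝ) ≤ 2 * L := by
    have h1 := Real.natLog_le_logb (n ^ 2) 2
    have h2 : Real.logb 2 ((n : ℝ) ^ 2) = 2 * L := by
      rw [Real.logb_pow]; norm_num [hL]
    push_cast at h1
    linarith
  have hq : (Nat.sqrt (2 * (n * s)) : ℝ) ≤ 1.5 * R := by
    have h1 : Nat.sqrt (2 * (n * s)) * Nat.sqrt (2 * (n * s)) ≤ 2 * (n * s) := Nat.sqrt_le _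
    have h2 : (Nat.sqrt (2 * (n * s)) : ℝ) * Nat.sqrt (2 * (n * s)) ≤ 2 * (n * s) := by
      exact_mod_cast h1
    rw [← hR2] at h2
    by_contra hlt
    push Not at hlt
    nlinarith
  have hsR : (s : ℝ) ≤ R := by
    by_contra hlt
    push Not at hlt
    nlinarith
  generalize Nat.sqrt (2 * (n * s)) = q at *
  generalize Nat.log 2 (n ^ 2) = J at *
  have b3 : k ≤ (q + 1) + (J + 1) * (2 * (q + 1)) + (q + 1) + s := by
    have := Nat.mul_le_mul_left (J + 1) (Nat.sub_le (2 * (q + 1)) 1)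
    omega
  have b4 : (k : ℝ) ≤ (q + 1) + (J + 1) * (2 * (q + 1)) + (q + 1) + s := by exact_mod_cast b3
  have hq1 : (q : ℝ) + 1 ≤ 1.6 * R := by linarith
  have hprod : ((J : ℝ) + 1) * (2 * (q + 1)) ≤ (2 * L + 1) * (3.2 * R) := by
    apply mul_le_mul <;> first | positivity | linarith
  nlinarith [mul_nonneg hR0 (sub_nonneg.2 hL3)]

end AltitudePaper
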